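/- arXiv:2006.07704 — 2 statements merged into one kernel-verified Lean document; each statement's English description precedes it below -/
import Mathlib

section
/- For all integers n ≥ 0 and k ≥ 1, one has (−1)^{k} ( Q(n) + 2 Σ_{j=1}^{k} (−1)^j Q(n − j²) − ε(n) ) ≥ 0, where ε(n) = (−1)^{T_m} if n = G_m for some (necessarily unique) integer m ≥ 0 and ε(n) = 0 otherwise; moreover the inequality is strict if and only if n ≥ (k+1)². -/
/-- The `n`-th triangular number `T n = n(n+1)/2`. -/
def T (n : ℕ) : ℕ := n * (n + 1) / 2

/-- The `n`-th generalized pentagonal number `G n = T n - T ⌊n/2⌋`. -/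
def G (n : ℕ) : ℕ := T n - T (n / 2)

/-- The number of partitions of `n` into distinct parts, vanishing on negative integers. -/
def Q (n : ℤ) : ℤ :=
  if 0 ≤ n then ((Nat.Partition.distincts n.toNat).card : ℤ) else 0

open Classical in
/-- `ε(n) = (-1)^(T m)` if `n = G m` for the (unique) `m`, and `0` otherwise. -/
noncomputable def eps (n : ℕ) : ℤ := if h : ∃ m, n = G m then (-1) ^ (T h.choose) else 0

/-- Telescoping of the sum that measures how the right-hand side of
`prod_one_add_pow_mul_theta` changes from one step to the next. -/
theorem sum_range_telescope {R : Type*} [CommRing R] (x y : R) (n m : ℕ) (hm : m ≤ n) :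
    ∑ s ∈ Finset.range (m + 1), (-1) ^ s * (∏ i ∈ Finset.range s, (1 + x ^ i)) *
      (∏ i ∈ Finset.Ico s n, (1 - x ^ (i + 1))) * y ^ s * ((1 - y) * x ^ s - (1 + y)) =
    (-1) ^ (m + 1) * (∏ i ∈ Finset.range (m + 1), (1 + x ^ i)) *
      (∏ i ∈ Finset.Ico m n, (1 - x ^ (i + 1))) * y ^ (m + 1) := by
  induction m with
  | zero => simp; ring
  | succ m ih =>
    rw [Finset.sum_range_succ, ih (by omega), Finset.prod_range_succ _ (m + 1),
      Finset.prod_eq_prod_Ico_succ_bot (by omega : m < n)]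
    ring

/-- A finite form of Gauss's identity for `∑ (-1) ^ j * x ^ (j ^ 2)`. -/
theorem prod_one_add_pow_mul_theta {R : Type*} [CommRing R] (x : R) (n : ℕ) :
    (∏ i ∈ Finset.range n, (1 + x ^ (i + 1))) *
      (1 + 2 * ∑ j ∈ Finset.Icc 1 n, (-1) ^ j * x ^ (j ^ 2)) =
    ∑ s ∈ Finset.range (n + 1), (-1) ^ s * (∏ i ∈ Finset.range s, (1 + x ^ i)) *
      (∏ i ∈ Finset.Ico s n, (1 - x ^ (i + 1))) * (x ^ (n + 1)) ^ s := by
  induction n with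
  | zero => simp
  | succ n ih =>
    have key := sum_range_telescope x (x ^ (n + 1)) n n le_rfl
    have step : ∑ s ∈ Finset.range (n + 1), (-1) ^ s * (∏ i ∈ Finset.range s, (1 + x ^ i)) *
        (∏ i ∈ Finset.Ico s (n + 1), (1 - x ^ (i + 1))) * (x ^ (n + 1 + 1)) ^ s =
        ∑ s ∈ Finset.range (n + 1), ((-1) ^ s * (∏ i ∈ Finset.range s, (1 + x ^ i)) *
          (∏ i ∈ Finset.Ico s n, (1 - x ^ (i + 1))) * (x ^ (n + 1)) ^ s *
          ((1 - x ^ (n + 1)) * x ^ s - (1 + x ^ (n + 1))) +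
        (1 + x ^ (n + 1)) * ((-1) ^ s * (∏ i ∈ Finset.range s, (1 + x ^ i)) *
          (∏ i ∈ Finset.Ico s n, (1 - x ^ (i + 1))) * (x ^ (n + 1)) ^ s)) := by
      refine Finset.sum_congr rfl fun s hs => ?_
      rw [Finset.prod_Ico_succ_top (by simpa [Nat.lt_succ_iff] using hs)]
      ring
    rw [Finset.sum_range_succ, step, Finset.sum_add_distrib, key, ← Finset.mul_sum, ← ih,
      Finset.sum_Icc_succ_top (by omega), Finset.prod_range_succ, Finset.Ico_self,
      Finset.Ico_self, Finset.prod_range_succ' _ n]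
    simp only [Finset.prod_empty]
    ring

theorem Q_natCast (n : ℕ) : Q n = (Nat.Partition.distincts n).card := by
  simp [Q]

theorem Q_of_neg {n : ℤ} (h : n < 0) : Q n = 0 := by
  simp [Q, h]

theorem Q_nonneg (n : ℤ) : 0 ≤ Q n := by
  unfold Q; split_ifs <;> simp

namespace Nat.Partition

/-- Adjoin `d` parts equal to one to a partition. -/
def addOnes {n : ℕ} (d : ℕ) (p : n.Partition) : (n + d).Partition where
  parts := p.parts + Multiset.replicate d 1
  parts_pos := by
    intro i hi
    rcases Multiset.mem_add.1 hi with h | h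
    · exact p.parts_pos h
    · simp [Multiset.eq_of_mem_replicate h]
  parts_sum := by simp [p.parts_sum]

theorem addOnes_injective {n : ℕ} (d : ℕ) :
    Function.Injective (addOnes d : n.Partition → (n + d).Partition) := by
  intro p q h
  have := congrArg parts h
  exact Nat.Partition.ext (by simpa [addOnes] using this)

theorem mem_odds {n : ℕ} {p : n.Partition} : p ∈ odds n ↔ ∀ i ∈ p.parts, ¬ Even i := by
  simp [odds, restricted]

theorem addOnes_mem_odds {n : ℕ} (d : ℕ) {p : n.Partition} (hp : p ∈ odds n) :
    addOnes d p ∈ odds (n + d) := by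
  rw [mem_odds] at hp ⊢
  intro i hi
  rcases Multiset.mem_add.1 hi with h | h
  · exact hp i h
  · simp [Multiset.eq_of_mem_replicate h]

theorem card_distincts_mono (n d : ℕ) : (distincts n).card ≤ (distincts (n + d)).card := by
  rw [← card_odds_eq_card_distincts, ← card_odds_eq_card_distincts]
  exact Finset.card_le_card_of_injOn _ (fun p hp => addOnes_mem_odds d hp)
    (addOnes_injective d).injOn

theorem exists_mem_odds_count_one_le {n : ℕ} (hn : 3 ≤ n) :
    ∃ p ∈ odds n, p.parts.count 1 ≤ 1 := by
  rcases Nat.even_or_odd n with h | h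
  · refine ⟨⟨{n - 1, 1}, ?_, ?_⟩, ?_, ?_⟩
    · intro i hi
      simp at hi
      omega
    · simp
      omega
    · rw [mem_odds]
      intro i hi
      simp at hi
      grind
    · simp [Multiset.count_cons]
      omega
  · refine ⟨⟨{n}, ?_, ?_⟩, ?_, ?_⟩
    · intro i hi
      simp at hi
      omega
    · simp
    · rw [mem_odds]
      intro i hi
      simp at hi
      grind
    · rw [Multiset.count_singleton]
      split_ifs <;> omega

theorem card_distincts_strict (n d : ℕ) (hd : 3 ≤ d) :
    (distincts n).card < (distincts (n + d)).card := by
  rw [← card_odds_eq_card_distincts, ← card_odds_eq_card_distincts,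
    ← Finset.card_image_of_injective (odds n) (addOnes_injective d)]
  apply Finset.card_lt_card
  refine Finset.ssubset_iff_subset_ne.2 ⟨?_, fun heq => ?_⟩
  · intro q hq
    obtain ⟨p, hp, rfl⟩ := Finset.mem_image.1 hq
    exact addOnes_mem_odds d hp
  · obtain ⟨q, hq, hc⟩ := exists_mem_odds_count_one_le (n := n + d) (by omega)
    obtain ⟨p, -, rfl⟩ := Finset.mem_image.1 (heq ▸ hq)
    simp [addOnes] at hc
    omega

end Nat.Partition

theorem Q_mono : Monotone Q := by
  intro a b hab
  rcases lt_or_ge a 0 with ha | ha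
  · rw [Q_of_neg ha]
    exact Q_nonneg b
  · lift a to ℕ using ha
    obtain ⟨d, rfl⟩ := Int.le.dest hab
    have := Nat.Partition.card_distincts_mono a d
    rw [← Nat.cast_add, Q_natCast, Q_natCast]
    exact_mod_cast this

theorem Q_lt_Q {a b : ℤ} (hb : 0 ≤ b) (hab : a + 3 ≤ b) : Q a < Q b := by
  rcases lt_or_ge a 0 with ha | ha
  · rw [Q_of_neg ha]
    refine lt_of_lt_of_le ?_ (Q_mono hb)
    decide
  · lift a to ℕ using ha
    obtain ⟨d, rfl⟩ := Int.le.dest (show (a : ℤ) ≤ b by omega)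
    have := Nat.Partition.card_distincts_strict a d (by omega)
    rw [← Nat.cast_add, Q_natCast, Q_natCast]
    exact_mod_cast this

theorem T_two_mul (j : ℕ) : T (2 * j) = j * (2 * j + 1) := by
  rw [T, mul_assoc, Nat.mul_div_cancel_left _ two_pos]

theorem T_two_mul_add_one (j : ℕ) : T (2 * j + 1) = (2 * j + 1) * (j + 1) := by
  rw [T, show (2 * j + 1) * (2 * j + 1 + 1) = 2 * ((2 * j + 1) * (j + 1)) by ring,
    Nat.mul_div_cancel_left _ two_pos]

theorem two_mul_T (j : ℕ) : 2 * T j = j * (j + 1) :=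
  Nat.mul_div_cancel' (Nat.even_mul_succ_self j).two_dvd

theorem G_two_mul (j : ℕ) : G (2 * j) = pentagonal (-j) := by
  have h := two_mul_natCast_pentagonal_neg j
  have h2 := two_mul_T j
  rw [G, T_two_mul, Nat.mul_div_cancel_left _ two_pos]
  zify at h2
  have hle : T j ≤ j * (2 * j + 1) := by zify; nlinarith
  zify [hle]
  linarith

theorem G_two_mul_add_one (j : ℕ) : G (2 * j + 1) = pentagonal (j + 1) := by
  have h := two_mul_natCast_pentagonal (j + 1)
  have h2 := two_mul_T j
  rw [G, T_two_mul_add_one, show (2 * j + 1) / 2 = j by omega]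
  zify at h2
  have hle : T j ≤ (2 * j + 1) * (j + 1) := by zify; nlinarith
  zify [hle]
  linarith

theorem coeff_pentagonalSeries_G (m : ℕ) :
    (PowerSeries.pentagonalSeries ℤ).coeff (G m) = (-1) ^ T m := by
  obtain ⟨j, rfl | rfl⟩ := Nat.even_or_odd' m
  · rw [G_two_mul, PowerSeries.coeff_pentagonalSeries_pentagonal, Int.negOnePow_neg, T_two_mul,
      mul_comm, pow_mul, Odd.neg_one_pow (by simp)]
    simp [Int.negOnePow_def]
  · rw [G_two_mul_add_one, PowerSeries.coeff_pentagonalSeries_pentagonal, T_two_mul_add_one,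
      pow_mul, Odd.neg_one_pow (by simp), ← Nat.cast_add_one, Int.negOnePow_def, zpow_natCast]
    simp

theorem exists_pentagonal_eq_G (k : ℤ) : ∃ m, pentagonal k = G m := by
  rcases le_or_gt k 0 with hk | hk
  · refine ⟨2 * k.natAbs, ?_⟩
    rw [G_two_mul]
    congr 1
    omega
  · refine ⟨2 * (k.natAbs - 1) + 1, ?_⟩
    rw [G_two_mul_add_one]
    congr 1
    omega

theorem eps_eq_coeff (n : ℕ) : eps n = (PowerSeries.pentagonalSeries ℤ).coeff n := by
  unfold eps
  split_ifs with h
  · rw [← coeff_pentagonalSeries_G, ← h.choose_spec]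
  · rw [PowerSeries.coeff_pentagonalSeries_eq_zero]
    rintro ⟨k, rfl⟩
    exact h (exists_pentagonal_eq_G k)

section

open PowerSeries Filter
open scoped PowerSeries.WithPiTopology

theorem eventually_coeff_prod_one_add (i : ℕ) : ∀ᶠ N in atTop,
    (∏ j ∈ Finset.range N, (1 + X ^ (j + 1) : ℤ⟦X⟧)).coeff i = Q i := by
  have h := Nat.Partition.hasProd_powerSeriesMk_card_countRestricted ℤ (m := 2) (by norm_num)
  have h2 := (WithPiTopology.tendsto_iff_coeff_tendsto _ _ _ _).1 h.tendsto_prod_nat i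
  rw [nhds_discrete, tendsto_pure] at h2
  simpa [Finset.sum_range_succ, Nat.Partition.countRestricted_two, Q_natCast] using h2

theorem eventually_coeff_prod_one_sub (n : ℕ) : ∀ᶠ N in atTop,
    (∏ j ∈ Finset.range N, (1 - X ^ (j + 1) : ℤ⟦X⟧)).coeff n = eps n := by
  rw [eps_eq_coeff]
  exact tendsto_finset_range.eventually (coeff_prod_one_sub_X_pow_eventually_eq ℤ n)

theorem exists_Q_add_two_mul_sum_eq_eps (n k : ℕ) : ∃ N ≥ k,
    Q n + 2 * ∑ j ∈ Finset.Icc 1 N, (-1 : ℤ) ^ j * Q ((n : ℤ) - (j : ℤ) ^ 2) = eps n := by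
  have hQ : ∀ᶠ N in atTop, ∀ i ∈ Finset.range (n + 1),
      (∏ j ∈ Finset.range N, (1 + X ^ (j + 1) : ℤ⟦X⟧)).coeff i = Q i :=
    (Finset.eventually_all _).2 fun i _ => eventually_coeff_prod_one_add i
  obtain ⟨N, hN, hE, hn, hk⟩ := (hQ.and ((eventually_coeff_prod_one_sub n).and
    ((eventually_ge_atTop n).and (eventually_ge_atTop k)))).exists
  refine ⟨N, hk, ?_⟩
  have key := congrArg (coeff n) (prod_one_add_pow_mul_theta (X : ℤ⟦X⟧) N)
  have hR : coeff n (∑ s ∈ Finset.range (N + 1), (-1) ^ s * (∏ i ∈ Finset.range s, (1 + X ^ i)) *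
      (∏ i ∈ Finset.Ico s N, (1 - X ^ (i + 1))) * (X ^ (N + 1)) ^ s : ℤ⟦X⟧) = eps n := by
    rw [Finset.sum_range_succ', map_add, map_sum, Finset.sum_eq_zero, zero_add, ← hE]
    · simp
    · intro s _
      rw [← pow_mul, coeff_mul_X_pow', if_neg]
      nlinarith
  have hterm : ∀ j : ℕ, coeff n ((∏ i ∈ Finset.range N, (1 + X ^ (i + 1))) *
      ((-1) ^ j * X ^ (j ^ 2)) : ℤ⟦X⟧) = (-1) ^ j * Q ((n : ℤ) - (j : ℤ) ^ 2) := by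
    intro j
    rw [mul_left_comm, show ((-1 : ℤ⟦X⟧)) ^ j = C ((-1 : ℤ) ^ j) by simp, coeff_C_mul,
      coeff_mul_X_pow']
    congr 1
    split_ifs with h
    · rw [hN _ (by simp)]
      push_cast [h]
      rfl
    · rw [Q_of_neg]
      have : (n : ℤ) < (j ^ 2 : ℕ) := by exact_mod_cast not_le.1 h
      push_cast at this
      omega
  rw [hR, mul_add, mul_one, mul_left_comm, Finset.mul_sum, show (2 : ℤ⟦X⟧) = C (2 : ℤ) by simp,
    map_add, coeff_C_mul, map_sum, hN n (by simp)] at key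
  simpa only [hterm] using key

end

theorem sum_range_succ_alternating (n : ℤ) (L k : ℕ) :
    ∑ i ∈ Finset.range (L + 1), (-1 : ℤ) ^ i * Q (n - ((k + i : ℕ) : ℤ) ^ 2) =
      Q (n - (k : ℤ) ^ 2) -
        ∑ i ∈ Finset.range L, (-1 : ℤ) ^ i * Q (n - ((k + 1 + i : ℕ) : ℤ) ^ 2) := by
  rw [Finset.sum_range_succ', add_comm, sub_eq_add_neg (Q _), ← Finset.sum_neg_distrib]
  congr 1
  · simp
  · refine Finset.sum_congr rfl fun i _ => ?_
    rw [show k + (i + 1) = k + 1 + i by ring]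
    ring

theorem sum_Icc_sub_sum_Icc_alternating (n : ℤ) (k L : ℕ) :
    (-1 : ℤ) ^ k * (∑ j ∈ Finset.Icc 1 k, (-1 : ℤ) ^ j * Q (n - (j : ℤ) ^ 2) -
        ∑ j ∈ Finset.Icc 1 (k + L), (-1 : ℤ) ^ j * Q (n - (j : ℤ) ^ 2)) =
      ∑ i ∈ Finset.range L, (-1 : ℤ) ^ i * Q (n - ((k + 1 + i : ℕ) : ℤ) ^ 2) := by
  induction L with
  | zero => simp
  | succ L ih =>
    rw [Finset.sum_range_succ, ← ih, ← add_assoc, Finset.sum_Icc_succ_top (by omega),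
      show k + 1 + L = k + L + 1 by ring, pow_succ, pow_add]
    have h : (-1 : ℤ) ^ k * (-1) ^ k = 1 := by rw [← mul_pow]; simp
    linear_combination (-1 : ℤ) ^ L * Q (n - ((k + L + 1 : ℕ) : ℤ) ^ 2) * h

/-- An alternating sum of the decreasing values `Q (n - j ^ 2)` lies between zero and its
first term. -/
theorem alternating_sum_mem_Icc (n : ℤ) (L k : ℕ) :
    ∑ i ∈ Finset.range L, (-1 : ℤ) ^ i * Q (n - ((k + i : ℕ) : ℤ) ^ 2) ∈
      Set.Icc 0 (Q (n - (k : ℤ) ^ 2)) := by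
  induction L generalizing k with
  | zero => simpa using Q_nonneg _
  | succ L ih =>
    obtain ⟨h1, h2⟩ := ih (k + 1)
    have hm : Q (n - ((k + 1 : ℕ) : ℤ) ^ 2) ≤ Q (n - (k : ℤ) ^ 2) := by
      apply Q_mono
      push_cast
      nlinarith [Int.natCast_nonneg k]
    rw [sum_range_succ_alternating]
    exact ⟨by linarith, by linarith⟩

theorem alternating_sum_pos {n : ℤ} {L k : ℕ} (hk : 1 ≤ k) (hn : (k : ℤ) ^ 2 ≤ n) (hL : 0 < L) :
    0 < ∑ i ∈ Finset.range L, (-1 : ℤ) ^ i * Q (n - ((k + i : ℕ) : ℤ) ^ 2) := by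
  obtain ⟨L, rfl⟩ := Nat.exists_eq_succ_of_ne_zero hL.ne'
  have h2 := (alternating_sum_mem_Icc n L (k + 1)).2
  have hlt : Q (n - ((k + 1 : ℕ) : ℤ) ^ 2) < Q (n - (k : ℤ) ^ 2) := by
    apply Q_lt_Q (by linarith)
    push_cast
    nlinarith
  rw [sum_range_succ_alternating]
  linarith

theorem stmt_3 (n k : ℕ) (hk : 1 ≤ k) :
    0 ≤ (-1 : ℤ) ^ k *
        (Q (n : ℤ) + 2 * ∑ j ∈ Finset.Icc 1 k, (-1 : ℤ) ^ j * Q ((n : ℤ) - (j : ℤ) ^ 2) - eps n) ∧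
    (0 < (-1 : ℤ) ^ k *
        (Q (n : ℤ) + 2 * ∑ j ∈ Finset.Icc 1 k, (-1 : ℤ) ^ j * Q ((n : ℤ) - (j : ℤ) ^ 2) - eps n) ↔
      (k + 1) ^ 2 ≤ n) := by
  obtain ⟨N, hN, hE⟩ := exists_Q_add_two_mul_sum_eq_eps n (k + 1)
  obtain ⟨L, rfl⟩ := Nat.exists_eq_add_of_le (show k ≤ N by omega)
  have h := sum_Icc_sub_sum_Icc_alternating n k L
  obtain ⟨h0, h1⟩ := alternating_sum_mem_Icc n L (k + 1)
  rw [show (-1 : ℤ) ^ k * (Q (n : ℤ) + 2 * ∑ j ∈ Finset.Icc 1 k, (-1 : ℤ) ^ j *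
      Q ((n : ℤ) - (j : ℤ) ^ 2) - eps n) = 2 * ∑ i ∈ Finset.range L, (-1 : ℤ) ^ i *
      Q (n - ((k + 1 + i : ℕ) : ℤ) ^ 2) by rw [← h, ← hE]; ring]
  refine ⟨by linarith, fun hpos => ?_, fun hn => ?_⟩
  · by_contra! hlt
    rw [Q_of_neg (by zify at hlt; push_cast; linarith)] at h1
    linarith
  · have := alternating_sum_pos (n := n) (L := L) (k := k + 1) (by omega)
      (by exact_mod_cast hn) (by omega)
    linarith
end

section
/- For every positive integer n, the number of ordered pairs (a, b) of nonnegative integers such that G_a + G_b = n is odd if and only if n = 2G_m for some integer m ≥ 0 (i.e., n is twice a generalized pentagonal number). -/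
lemma T_succ (n : ℕ) : T (n + 1) = T n + (n + 1) := by
  unfold T
  rw [show (n + 1) * (n + 1 + 1) = n * (n + 1) + (n + 1) * 2 by ring,
    Nat.add_mul_div_right _ _ two_pos]

lemma T_mono : Monotone T :=
  monotone_nat_of_le_succ fun n => by rw [T_succ]; omega

lemma G_strictMono : StrictMono G := by
  refine strictMono_nat_of_lt_succ fun n => ?_
  have h_half : T (n / 2) ≤ T n := T_mono (Nat.div_le_self n 2)
  have h_cases : (n + 1) / 2 = n / 2 ∨ (n + 1) / 2 = n / 2 + 1 ∧ 0 < n := by omega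
  unfold G
  rcases h_cases with h | ⟨h, hpos⟩
  · rw [h, T_succ]; omega
  · rw [h, T_succ, T_succ]; omega

theorem stmt_15 (n : ℕ) (hn : 0 < n) :
    Odd (Nat.card {p : ℕ × ℕ // G p.1 + G p.2 = n}) ↔ ∃ m, n = 2 * G m := by
  have h_finite : Finite {p : ℕ × ℕ // G p.1 + G p.2 = n} := by
    refine ((Set.finite_Iic (n, n)).subset fun p (hp : G p.1 + G p.2 = n) => ?_).to_subtype
    have h₁ := G_strictMono.le_apply (x := p.1)
    have h₂ := G_strictMono.le_apply (x := p.2)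
    exact ⟨by dsimp only; omega, by dsimp only; omega⟩
  have := Fintype.ofFinite {p : ℕ × ℕ // G p.1 + G p.2 = n}
  classical
  let swap : Function.End {p : ℕ × ℕ // G p.1 + G p.2 = n} :=
    fun p => ⟨p.1.swap, (add_comm _ _).trans p.2⟩
  have h_mod : Fintype.card {p : ℕ × ℕ // G p.1 + G p.2 = n} ≡
      Fintype.card (Function.fixedPoints swap) [MOD 2] :=
    have : Fact (Nat.Prime 2) := ⟨Nat.prime_two⟩
    Equiv.Perm.card_fixedPoints_modEq (n := 1) (by rfl)
  have h_diag (p : Function.fixedPoints swap) : p.1.1.2 = p.1.1.1 :=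
    congrArg (fun q => q.1.1) p.2
  have h_sub : Subsingleton (Function.fixedPoints swap) := by
    refine ⟨fun p q => ?_⟩
    have hp := p.1.2
    have hq := q.1.2
    rw [h_diag] at hp hq
    have h_fst : p.1.1.1 = q.1.1.1 := G_strictMono.injective (by omega)
    exact Subtype.ext (Subtype.ext (Prod.ext h_fst (by rw [h_diag, h_diag, h_fst])))
  have h_le := Fintype.card_le_one_iff_subsingleton.mpr h_sub
  have h_nonempty : Nonempty (Function.fixedPoints swap) ↔ ∃ m, n = 2 * G m := by
    constructor
    · rintro ⟨p⟩
      have hp := p.1.2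
      rw [h_diag] at hp
      exact ⟨p.1.1.1, by omega⟩
    · rintro ⟨m, hm⟩
      exact ⟨⟨⟨(m, m), by dsimp only; omega⟩, rfl⟩⟩
  rw [Nat.card_eq_fintype_card, Nat.odd_iff, h_mod, ← h_nonempty, ← Fintype.card_pos_iff]
  omega
end
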